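/- Let α ∈ (1,2) and θ ∈ (0, 2π). Then the series T = ∑_{k=1}^{∞} sin(kθ) Γ(k+1−α)/Γ(k+2) converges, and sin θ − (α(α−1)/Γ(2−α)) · T = −(2 sin(θ/2))^α · sin( (θ − π)(1 − α/2) ). -/

import Mathlib

open Filter Topology

/-- The ratios `Γ(n+1-α)/Γ(n+1)` have decrements `α Γ(n+1-α)/Γ(n+2)`. -/
lemma Gamma_ratio_sub_succ {α x : ℝ} (hx : x ≠ 0) (hxα : x - α ≠ 0) (hG : Real.Gamma x ≠ 0) :
    Real.Gamma (x - α) / Real.Gamma x - Real.Gamma (x + 1 - α) / Real.Gamma (x + 1) =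
      α * (Real.Gamma (x - α) / Real.Gamma (x + 1)) := by
  rw [show x + 1 - α = (x - α) + 1 by ring, Real.Gamma_add_one hx, Real.Gamma_add_one hxα]
  field_simp
  ring

lemma summable_Gamma_ratio {α : ℝ} (h0 : 0 < α) (h2 : α < 2) :
    Summable fun k : ℕ => Real.Gamma ((k : ℝ) + 2 - α) / Real.Gamma ((k : ℝ) + 3) := by
  have hpos : ∀ k : ℕ, 0 < Real.Gamma ((k : ℝ) + 2 - α) := fun k =>
    Real.Gamma_pos_of_pos (by have : (0 : ℝ) ≤ k := k.cast_nonneg; linarith)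
  set b : ℕ → ℝ := fun k => Real.Gamma ((k : ℝ) + 2 - α) / Real.Gamma ((k : ℝ) + 2) with hb
  have hb0 : ∀ k, 0 ≤ b k := fun k =>
    div_nonneg (hpos k).le (Real.Gamma_pos_of_pos (by positivity)).le
  have hstep : ∀ k : ℕ, Real.Gamma ((k : ℝ) + 2 - α) / Real.Gamma ((k : ℝ) + 3) =
      (b k - b (k + 1)) / α := by
    intro k
    have hk : (0 : ℝ) ≤ k := k.cast_nonneg
    have h := Gamma_ratio_sub_succ (α := α) (x := (k : ℝ) + 2) (by positivity)
      (by linarith) (Real.Gamma_pos_of_pos (by positivity)).ne'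
    rw [eq_div_iff h0.ne']
    simp only [hb]
    push_cast
    rw [show (k : ℝ) + 1 + 2 = k + 2 + 1 by ring, h, show (k : ℝ) + 2 + 1 = k + 3 by ring]
    ring
  refine summable_of_sum_range_le (c := b 0 / α)
    (fun k => div_nonneg (hpos k).le (Real.Gamma_pos_of_pos (by positivity)).le) fun n => ?_
  simp_rw [hstep]
  rw [← Finset.sum_div, Finset.sum_range_sub']
  gcongr
  linarith [hb0 n]

lemma Ring.choose_succ_eq_mul_div {K : Type*} [Field K] [CharZero K] (a : K) (n : ℕ) :
    Ring.choose a (n + 1) = Ring.choose a n * (a - n) / (n + 1) := by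
  have h1 : (n.factorial : K) ≠ 0 := by exact_mod_cast n.factorial_ne_zero
  have h2 : (n : K) + 1 ≠ 0 := by exact_mod_cast n.succ_ne_zero
  rw [Ring.choose_eq_smul, Ring.choose_eq_smul, descPochhammer_succ_right, Nat.factorial_succ]
  simp only [Polynomial.smeval_mul, Polynomial.smeval_sub, Polynomial.smeval_X,
    Polynomial.smeval_natCast, smul_eq_mul]
  push_cast
  field_simp
  simp

lemma choose_mul_neg_one_pow_eq_Gamma {α : ℝ} (h2 : α < 2) (k : ℕ) :
    Ring.choose α (k + 2) * (-1) ^ (k + 2) = α * (α - 1) / Real.Gamma (2 - α) *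
      (Real.Gamma ((k : ℝ) + 2 - α) / Real.Gamma ((k : ℝ) + 3)) := by
  induction k with
  | zero =>
    have hG : Real.Gamma (2 - α) ≠ 0 := (Real.Gamma_pos_of_pos (by linarith)).ne'
    have h3 : Real.Gamma 3 = 2 := by simp
    rw [Ring.choose_succ_eq_mul_div, Ring.choose_succ_eq_mul_div, Ring.choose_zero_right]
    norm_num [h3]
    field_simp
  | succ k ih =>
    have hk : (0 : ℝ) ≤ k := k.cast_nonneg
    have hG3 : Real.Gamma ((k : ℝ) + 3) ≠ 0 := (Real.Gamma_pos_of_pos (by positivity)).ne'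
    have hG : Real.Gamma (2 - α) ≠ 0 := (Real.Gamma_pos_of_pos (by linarith)).ne'
    have e1 : Real.Gamma (((k + 1 : ℕ) : ℝ) + 2 - α) =
        ((k : ℝ) + 2 - α) * Real.Gamma ((k : ℝ) + 2 - α) := by
      rw [← Real.Gamma_add_one (by linarith)]
      push_cast
      ring_nf
    have e2 : Real.Gamma (((k + 1 : ℕ) : ℝ) + 3) = ((k : ℝ) + 3) * Real.Gamma ((k : ℝ) + 3) := by
      rw [← Real.Gamma_add_one (by positivity)]
      push_cast
      ring_nf
    have e3 : Ring.choose α (k + 1 + 2) * (-1) ^ (k + 1 + 2) =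
        Ring.choose α (k + 2) * (-1) ^ (k + 2) * (((k : ℝ) + 2 - α) / (k + 3)) := by
      rw [show k + 1 + 2 = (k + 2) + 1 by ring, Ring.choose_succ_eq_mul_div, pow_succ]
      push_cast
      rw [show (k : ℝ) + 2 + 1 = k + 3 by ring]
      ring
    rw [e3, ih, e1, e2]
    field_simp

lemma hasSum_one_sub_cpow (a : ℂ) {z : ℂ} (hz : ‖z‖ < 1) :
    HasSum (fun n : ℕ => Ring.choose a n * (-z) ^ n) ((1 - z) ^ a) := by
  have h := (Complex.one_add_cpow_hasFPowerSeriesOnBall_zero (a := a)).hasSum (y := -z)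
    (by
      rw [mem_eball_zero_iff, enorm_neg, ← ofReal_norm]
      exact ENNReal.ofReal_lt_one.2 hz)
  simpa only [binomialSeries_apply, List.ofFn_const, List.prod_replicate, smul_eq_mul, zero_add,
    sub_eq_add_neg] using h

lemma one_sub_exp_mul_I (θ : ℝ) :
    1 - Complex.exp (θ * Complex.I) =
      ((2 * Real.sin (θ / 2) : ℝ) : ℂ) *
        Complex.exp (((θ - Real.pi) / 2 : ℝ) * Complex.I) := by
  have e : Real.cos θ = 1 - 2 * Real.sin (θ / 2) ^ 2 := by
    rw [Real.sin_sq_eq_half_sub, mul_div_cancel₀ θ two_ne_zero]; ring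
  have s : Real.sin θ = 2 * Real.sin (θ / 2) * Real.cos (θ / 2) := by
    rw [← Real.sin_two_mul, mul_div_cancel₀ θ two_ne_zero]
  have c' : Real.cos ((θ - Real.pi) / 2) = Real.sin (θ / 2) := by
    rw [sub_div, Real.cos_sub_pi_div_two]
  have s' : Real.sin ((θ - Real.pi) / 2) = -Real.cos (θ / 2) := by
    rw [sub_div, Real.sin_sub_pi_div_two]
  apply Complex.ext
  · rw [Complex.re_ofReal_mul, Complex.sub_re, Complex.exp_ofReal_mul_I_re,
      Complex.exp_ofReal_mul_I_re, c', e, Complex.one_re]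
    ring
  · rw [Complex.im_ofReal_mul, Complex.sub_im, Complex.exp_ofReal_mul_I_im,
      Complex.exp_ofReal_mul_I_im, s', s, Complex.one_im]
    ring

lemma one_sub_exp_mul_I_cpow (α : ℝ) {θ : ℝ} (h0 : 0 < θ) (h1 : θ < 2 * Real.pi) :
    (1 - Complex.exp (θ * Complex.I)) ^ (α : ℂ) =
      (((2 * Real.sin (θ / 2)) ^ α : ℝ) : ℂ) *
        Complex.exp ((α * ((θ - Real.pi) / 2) : ℝ) * Complex.I) := by
  have hs : 0 < 2 * Real.sin (θ / 2) :=
    mul_pos two_pos (Real.sin_pos_of_pos_of_lt_pi (by linarith) (by linarith))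
  rw [one_sub_exp_mul_I,
    Complex.cpow_def_of_ne_zero (mul_ne_zero (by exact_mod_cast hs.ne') (Complex.exp_ne_zero _)),
    Complex.log_ofReal_mul hs (Complex.exp_ne_zero _), Complex.log_exp, add_mul, Complex.exp_add,
    Complex.ofReal_cpow hs.le, Complex.cpow_def_of_ne_zero (by exact_mod_cast hs.ne'),
    Complex.ofReal_log hs.le]
  · congr 2
    push_cast
    ring
  · simp only [Complex.im_ofReal_mul, Complex.I_im]
    linarith
  · simp only [Complex.im_ofReal_mul, Complex.I_im]
    linarith

/-- The binomial series of `(1 - z) ^ α` still converges on the unit circle away from `1`. -/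
lemma hasSum_one_sub_exp_mul_I_cpow {α θ : ℝ} (hα0 : 0 < α) (hα2 : α < 2)
    (h0 : 0 < θ) (h1 : θ < 2 * Real.pi) :
    HasSum (fun n : ℕ => Ring.choose (α : ℂ) n * (-Complex.exp (θ * Complex.I)) ^ n)
      ((1 - Complex.exp (θ * Complex.I)) ^ (α : ℂ)) := by
  set w := Complex.exp (θ * Complex.I) with hw
  have hnorm : ‖w‖ = 1 := Complex.norm_exp_ofReal_mul_I θ
  have hsum : Summable fun n : ℕ => Ring.choose (α : ℂ) n * (-w) ^ n := by
    rw [← summable_nat_add_iff 2]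
    refine Summable.of_norm ?_
    have h := ((summable_Gamma_ratio hα0 hα2).mul_left
      (α * (α - 1) / Real.Gamma (2 - α))).norm
    refine h.congr fun k => ?_
    rw [← choose_mul_neg_one_pow_eq_Gamma hα2, ← Complex.ofReal_choose]
    simp [hnorm]
  have habel := Complex.tendsto_tsum_powerSeries_nhdsWithin_lt hsum.hasSum.tendsto_sum_nat
  rw [tendsto_map'_iff] at habel
  have hcont : Tendsto (fun x : ℝ => (1 - (x : ℂ) * w) ^ (α : ℂ)) (𝓝[<] 1)
      (𝓝 ((1 - w) ^ (α : ℂ))) := by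
    have hs : 0 < Real.sin (θ / 2) := Real.sin_pos_of_pos_of_lt_pi (by linarith) (by linarith)
    have hmem : 1 - ((1 : ℝ) : ℂ) * w ∈ Complex.slitPlane := by
      left
      rw [Complex.ofReal_one, one_mul, hw, one_sub_exp_mul_I, Complex.re_ofReal_mul,
        Complex.exp_ofReal_mul_I_re, sub_div, Real.cos_sub_pi_div_two]
      positivity
    have hc : ContinuousAt (fun x : ℝ => (1 - (x : ℂ) * w) ^ (α : ℂ)) 1 :=
      ContinuousAt.cpow (by fun_prop) continuousAt_const hmem
    simpa using hc.tendsto.mono_left nhdsWithin_le_nhds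
  have heq : (fun x : ℝ => (1 - (x : ℂ) * w) ^ (α : ℂ)) =ᶠ[𝓝[<] 1]
      ((fun z : ℂ => ∑' n : ℕ, Ring.choose (α : ℂ) n * (-w) ^ n * z ^ n) ∘ Complex.ofReal) := by
    filter_upwards [Ioo_mem_nhdsLT (zero_lt_one' ℝ)] with x hx
    have hx' : ‖(x : ℂ) * w‖ < 1 := by
      rw [norm_mul, hnorm, mul_one, Complex.norm_real, Real.norm_of_nonneg hx.1.le]
      exact hx.2
    rw [← (hasSum_one_sub_cpow (α : ℂ) hx').tsum_eq]
    refine tsum_congr fun n => ?_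
    rw [neg_mul_eq_mul_neg, mul_pow]
    ring
  rw [tendsto_nhds_unique (hcont.congr' heq) habel]
  exact hsum.hasSum

/-- For `α ∈ (1,2)` and `θ ∈ (0,2π)`, the series `T = ∑_{k=1}^∞ sin(kθ) Γ(k+1−α)/Γ(k+2)`
converges and `sin θ − (α(α−1)/Γ(2−α)) T = −(2 sin(θ/2))^α sin((θ−π)(1−α/2))`. -/
theorem stmt9 (α θ : ℝ) (hα : α ∈ Set.Ioo (1 : ℝ) 2)
    (hθ : θ ∈ Set.Ioo (0 : ℝ) (2 * Real.pi)) :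
    ∃ T : ℝ,
      HasSum (fun k : ℕ =>
        Real.sin (((k : ℝ) + 1) * θ) *
          (Real.Gamma (((k : ℝ) + 1) + 1 - α) / Real.Gamma (((k : ℝ) + 1) + 2))) T ∧
      Real.sin θ - (α * (α - 1) / Real.Gamma (2 - α)) * T =
        -((2 * Real.sin (θ / 2)) ^ α * Real.sin ((θ - Real.pi) * (1 - α / 2))) := by
  obtain ⟨hα1, hα2⟩ := hα
  obtain ⟨h0, h1⟩ := hθ
  have hα0 : 0 < α := by linarith
  set c : ℝ := α * (α - 1) / Real.Gamma (2 - α) with hc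
  have hc0 : c ≠ 0 :=
    (div_pos (mul_pos hα0 (by linarith)) (Real.Gamma_pos_of_pos (by linarith))).ne'
  have hsum := hasSum_one_sub_exp_mul_I_cpow hα0 hα2 h0 h1
  rw [one_sub_exp_mul_I_cpow α h0 h1, ← hasSum_nat_add_iff' 2] at hsum
  have him := Complex.hasSum_im (hsum.mul_left (Complex.exp ((-θ : ℝ) * Complex.I)))
  have hterm : ∀ k : ℕ, (Complex.exp ((-θ : ℝ) * Complex.I) * (Ring.choose (α : ℂ) (k + 2) *
      (-Complex.exp (θ * Complex.I)) ^ (k + 2))).im =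
      c * (Real.sin (((k : ℝ) + 1) * θ) *
          (Real.Gamma (((k : ℝ) + 1) + 1 - α) / Real.Gamma (((k : ℝ) + 1) + 2))) := by
    intro k
    have hexp : Complex.exp ((-θ : ℝ) * Complex.I) * Complex.exp (θ * Complex.I) ^ (k + 2) =
        Complex.exp (((((k : ℝ) + 1) * θ : ℝ) : ℂ) * Complex.I) := by
      rw [← Complex.exp_nat_mul, ← Complex.exp_add]
      congr 1
      push_cast
      ring
    have hfac : Complex.exp ((-θ : ℝ) * Complex.I) * (Ring.choose (α : ℂ) (k + 2) *
        (-Complex.exp (θ * Complex.I)) ^ (k + 2)) =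
        ((Ring.choose α (k + 2) * (-1) ^ (k + 2) : ℝ) : ℂ) *
          Complex.exp (((((k : ℝ) + 1) * θ : ℝ) : ℂ) * Complex.I) := by
      rw [← hexp, neg_pow, ← Complex.ofReal_choose]
      push_cast
      ring
    rw [hfac, Complex.im_ofReal_mul, Complex.exp_ofReal_mul_I_im,
      choose_mul_neg_one_pow_eq_Gamma hα2, ← hc, show (k : ℝ) + 1 + 1 - α = k + 2 - α by ring,
      show (k : ℝ) + 1 + 2 = k + 3 by ring]
    ring
  simp_rw [hterm] at him
  have hT := him.mul_left c⁻¹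
  simp_rw [inv_mul_cancel_left₀ hc0] at hT
  refine ⟨_, hT, ?_⟩
  rw [mul_inv_cancel_left₀ hc0]
  have hval : Complex.exp ((-θ : ℝ) * Complex.I) *
      ((((2 * Real.sin (θ / 2)) ^ α : ℝ) : ℂ) *
        Complex.exp ((α * ((θ - Real.pi) / 2) : ℝ) * Complex.I) -
      ∑ i ∈ Finset.range 2, Ring.choose (α : ℂ) i * (-Complex.exp (θ * Complex.I)) ^ i) =
      (((2 * Real.sin (θ / 2)) ^ α : ℝ) : ℂ) *
        Complex.exp ((α * ((θ - Real.pi) / 2) - θ : ℝ) * Complex.I) -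
      Complex.exp ((-θ : ℝ) * Complex.I) + (α : ℂ) := by
    have e1 : Complex.exp ((α * ((θ - Real.pi) / 2) - θ : ℝ) * Complex.I) =
        Complex.exp ((-θ : ℝ) * Complex.I) *
          Complex.exp ((α * ((θ - Real.pi) / 2) : ℝ) * Complex.I) := by
      rw [← Complex.exp_add]
      congr 1
      push_cast
      ring
    have e2 : Complex.exp ((-θ : ℝ) * Complex.I) * Complex.exp (θ * Complex.I) = 1 := by
      rw [← Complex.exp_add]
      simp
    rw [e1, Finset.sum_range_succ, Finset.sum_range_one, Ring.choose_zero_right,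
      Ring.choose_one_right]
    linear_combination (α : ℂ) * e2
  have hsin : Real.sin (α * ((θ - Real.pi) / 2) - θ) =
      Real.sin ((θ - Real.pi) * (1 - α / 2)) := by
    rw [← Real.sin_add_two_pi, ← Real.sin_pi_sub ((θ - Real.pi) * (1 - α / 2))]
    ring_nf
  rw [hval, Complex.add_im, Complex.sub_im, Complex.im_ofReal_mul, Complex.exp_ofReal_mul_I_im,
    Complex.exp_ofReal_mul_I_im, Complex.ofReal_im, Real.sin_neg, hsin]
  ring
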